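/- Let M ≥ 2 and k ∈ {1,…,M−1} with M ≥ k + 2. Then the loss ψ1(s,y) := max{1 + (s_{∖y})_{[k]} − s_y, 0} is not top-k calibrated. Specifically, for any η ∈ Δ_M with η_1 > η_2 > … > η_M > 0 and η_k < Σ_{i=k+1}^M η_i (such η exists since M ≥ k+2), the vector a ∈ ℝ^M with a_1 = … = a_{k−1} = 1 and a_k = … = a_M = 0 is a global minimizer of s ↦ L_{ψ1}(s,η) but is not top-k preserving with respect to η; hence inf{L_{ψ1}(s,η) : s not top-k preserving w.r.t. η} = L_{ψ1}*(η). -/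

import Mathlib

open scoped BigOperators
open Classical in
noncomputable def kthLargestList (l : List ℝ) (j : ℕ) : ℝ :=
  (List.insertionSort (· ≥ ·) l).getD (j - 1) 0

noncomputable def kthLargest {M : ℕ} (v : Fin M → ℝ) (j : ℕ) : ℝ :=
  kthLargestList (List.ofFn v) j

noncomputable def kthLargestExcept {M : ℕ} (s : Fin M → ℝ) (y : Fin M) (j : ℕ) : ℝ :=
  kthLargestList ((List.ofFn s).eraseIdx y.val) j

def Simplex (M : ℕ) : Set (Fin M → ℝ) := {v | (∀ m, 0 ≤ v m) ∧ ∑ m, v m = 1}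

def TopkPreserving {M : ℕ} (k : ℕ) (y x : Fin M → ℝ) : Prop :=
  ∀ m : Fin M, (kthLargest x (k + 1) < x m → kthLargest y (k + 1) < y m) ∧
    (x m < kthLargest x k → y m < kthLargest y k)

noncomputable def condRisk {M : ℕ} (ψ : (Fin M → ℝ) → Fin M → ℝ) (s η : Fin M → ℝ) : ℝ :=
  ∑ m, η m * ψ s m

def TopkCalibrated (M k : ℕ) (ψ : (Fin M → ℝ) → Fin M → ℝ) : Prop :=
  ∀ η ∈ Simplex M,
    sInf {L | ∃ s, ¬ TopkPreserving k s η ∧ L = condRisk ψ s η} >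
    sInf {L | ∃ s, L = condRisk ψ s η}

def IsTopkSelector (M k : ℕ) (r : (Fin M → ℝ) → Finset (Fin M)) : Prop :=
  ∀ s, (r s).card = k ∧ ∀ i ∈ r s, ∀ j ∉ r s, s j ≤ s i

/-- `ψ1(s,y) = max{1 + (s_{∖y})_{[k]} − s_y, 0}` -/
noncomputable def psi1 {M : ℕ} (k : ℕ) (s : Fin M → ℝ) (y : Fin M) : ℝ :=
  max (1 + kthLargestExcept s y k - s y) 0

lemma aux_lt (M k : ℕ) (hk1 : 1 ≤ k) (hMk : k + 2 ≤ M) : k - 1 < M := by omega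

lemma aux_le_kth (l : List ℝ) (j : ℕ) (c : ℝ) (hj : 1 ≤ j)
    (h : j ≤ l.countP (fun x => decide (c ≤ x))) : c ≤ kthLargestList l j := by
  classical
  unfold kthLargestList
  have hs := List.pairwise_insertionSort (r := fun a b : ℝ => a ≥ b) l
  have hp := List.perm_insertionSort (r := fun a b : ℝ => a ≥ b) l
  rw [← hp.countP_eq] at h
  generalize hL : List.insertionSort (fun a b : ℝ => a ≥ b) l = L at *
  have hlen : j ≤ L.length := h.trans List.countP_le_length
  have hL' : L.getD (j-1) 0 = L[j-1]'(by omega) := by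
    rw [List.getD_eq_getElem]
  suffices hh : c ≤ L.getD (j-1) 0 by
    convert hh
  rw [hL']
  by_contra hc
  push Not at hc
  rw [← List.take_append_drop (j-1) L, List.countP_append] at h
  have h1 : (L.take (j-1)).countP (fun x => decide (c ≤ x)) ≤ j - 1 :=
    List.countP_le_length.trans (by simp)
  have h2 : (L.drop (j-1)).countP (fun x => decide (c ≤ x)) = 0 := by
    rw [List.countP_eq_zero]
    intro a ha
    rw [List.mem_drop_iff_getElem] at ha
    obtain ⟨i, hi, rfl⟩ := ha
    rw [List.pairwise_iff_getElem] at hs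
    have : L[j-1+i] ≤ L[j-1]'(by omega) := by
      rcases Nat.eq_zero_or_pos i with h0 | h0
      · subst h0; simp
      · exact hs (j-1) (j-1+i) (by omega) (by omega) (by omega)
    simp only [decide_eq_true_eq, not_le]
    linarith
  omega

lemma aux_kth_le (l : List ℝ) (j : ℕ) (c : ℝ) (hj : 1 ≤ j) (hc : 0 ≤ c)
    (h : l.countP (fun x => decide (c < x)) < j) : kthLargestList l j ≤ c := by
  classical
  unfold kthLargestList
  have hs := List.pairwise_insertionSort (r := fun a b : ℝ => a ≥ b) l
  have hp := List.perm_insertionSort (r := fun a b : ℝ => a ≥ b) l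
  rw [← hp.countP_eq] at h
  generalize hL : List.insertionSort (fun a b : ℝ => a ≥ b) l = L at *
  suffices hh : L.getD (j-1) 0 ≤ c by
    convert hh
  by_cases hlen : j - 1 < L.length
  · rw [List.getD_eq_getElem _ _ hlen]
    by_contra hcc
    push Not at hcc
    rw [← List.take_append_drop j L, List.countP_append] at h
    have h1 : (L.take j).countP (fun x => decide (c < x)) = (L.take j).length := by
      rw [List.countP_eq_length]
      intro a ha
      rw [List.mem_take_iff_getElem] at ha
      obtain ⟨i, hi, rfl⟩ := ha
      rw [List.pairwise_iff_getElem] at hs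
      have : L[j-1] ≤ L[i]'(by omega) := by
        rcases Nat.lt_or_ge i (j-1) with h0 | h0
        · exact hs i (j-1) (by omega) (by omega) h0
        · have : i = j - 1 := by omega
          subst this; exact le_rfl
      simp only [decide_eq_true_eq]
      linarith
    rw [h1, List.length_take] at h
    omega
  · rw [List.getD_eq_default _ _ (by omega)]
    exact hc

lemma aux_count {M : ℕ} (s : Fin M → ℝ) (p : ℝ → Prop) [DecidablePred p] :
    (List.ofFn s).countP (fun x => decide (p x)) =
      (Finset.univ.filter (fun i => p (s i))).card := by
  induction M with
  | zero => simp
  | succ n ih =>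
    rw [List.ofFn_succ, List.countP_cons, ih, Fin.card_filter_univ_succ]
    simp only [decide_eq_true_eq]
    split_ifs <;> simp

lemma aux_count_erase {M : ℕ} (s : Fin M → ℝ) (y : Fin M) (p : ℝ → Prop) [DecidablePred p] :
    ((List.ofFn s).eraseIdx y.val).countP (fun x => decide (p x)) + (if p (s y) then 1 else 0) =
      (Finset.univ.filter (fun i => p (s i))).card := by
  rw [← aux_count]
  have h := List.getElem_cons_eraseIdx_perm (l := List.ofFn s) (n := y.val) (by simp)
  rw [← h.countP_eq, List.countP_cons]
  simp

lemma aux_le_except {M : ℕ} (s : Fin M → ℝ) (y : Fin M) (k : ℕ) (c : ℝ) (hk : 1 ≤ k)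
    (S : Finset (Fin M)) (hS : k ≤ S.card) (h : ∀ i ∈ S, i ≠ y ∧ c ≤ s i) :
    c ≤ kthLargestExcept s y k := by
  apply aux_le_kth _ _ _ hk
  have h1 := aux_count_erase s y (fun x => c ≤ x)
  by_cases hy : c ≤ s y
  · have h2 : (insert y S).card ≤ (Finset.univ.filter (fun i => c ≤ s i)).card := by
      apply Finset.card_le_card
      intro i hi
      rw [Finset.mem_insert] at hi
      rcases hi with rfl | hi
      · simpa using hy
      · simpa using (h i hi).2
    rw [Finset.card_insert_of_notMem (fun hy' => (h y hy').1 rfl)] at h2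
    rw [if_pos hy] at h1
    omega
  · have h2 : S.card ≤ (Finset.univ.filter (fun i => c ≤ s i)).card := by
      apply Finset.card_le_card
      intro i hi
      simpa using (h i hi).2
    rw [if_neg hy] at h1
    omega

lemma aux_except_le {M : ℕ} (s : Fin M → ℝ) (y : Fin M) (k : ℕ) (c : ℝ) (hk : 1 ≤ k)
    (hc : 0 ≤ c) (h : (Finset.univ.filter (fun i => c < s i)).card < k) :
    kthLargestExcept s y k ≤ c := by
  apply aux_kth_le _ _ _ hk hc
  have h1 := aux_count_erase s y (fun x => c < x)
  omega

lemma aux_card_lt {M : ℕ} (k : ℕ) (hk : k ≤ M) :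
    (Finset.univ.filter (fun i : Fin M => (i : ℕ) < k)).card = k := by
  rw [Fin.card_filter_val_lt]
  omega

/-- Tail sums of an antitone vector are minimal among permutations. -/
lemma aux_tail {M : ℕ} (η : Fin M → ℝ) (h : ∀ i j : Fin M, i < j → η j < η i)
    (σ : Equiv.Perm (Fin M)) (t : ℕ) :
    ∑ i ∈ Finset.univ.filter (fun i : Fin M => t ≤ (i : ℕ)), η i ≤
      ∑ i ∈ Finset.univ.filter (fun i : Fin M => t ≤ (i : ℕ)), η (σ i) := by
  have hanti : Antivary η (fun i : Fin M => if t ≤ (i : ℕ) then (1 : ℝ) else 0) := by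
    intro i j hij
    have hlt : i < j := by
      by_contra hn
      have : (j : ℕ) ≤ i := by exact_mod_cast not_lt.mp hn
      dsimp only at hij
      split_ifs at hij <;> first | omega | (norm_num at hij)
    exact (h i j hlt).le
  have := hanti.sum_mul_le_sum_comp_perm_mul (σ := σ)
  simpa [Finset.sum_filter] using this

lemma aux_split {M : ℕ} (k : ℕ) (hk1 : 1 ≤ k) (hMk : k + 2 ≤ M) (f : Fin M → ℝ) :
    ∑ i ∈ Finset.univ.filter (fun i : Fin M => k - 1 ≤ (i : ℕ)), f i =
      f ⟨k - 1, aux_lt M k hk1 hMk⟩ + ∑ i ∈ Finset.univ.filter (fun i : Fin M => k ≤ (i : ℕ)), f i := by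
  rw [← Finset.sum_insert (by simp; omega)]
  apply Finset.sum_congr _ (fun _ _ => rfl)
  ext i
  simp only [Finset.mem_filter, Finset.mem_univ, true_and, Finset.mem_insert, Fin.ext_iff]
  omega

lemma aux_risk_a (M k : ℕ) (hk1 : 1 ≤ k) (hMk : k + 2 ≤ M) (η : Fin M → ℝ)
    (hpos : ∀ i, 0 < η i) :
    condRisk (psi1 k) (fun i => if (i : ℕ) < k - 1 then (1 : ℝ) else 0) η ≤
      ∑ i ∈ Finset.univ.filter (fun i : Fin M => k - 1 ≤ (i : ℕ)), η i := by
  unfold condRisk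
  rw [Finset.sum_filter]
  apply Finset.sum_le_sum
  intro y _
  have hx : kthLargestExcept (fun i : Fin M => if (i : ℕ) < k - 1 then (1 : ℝ) else 0) y k ≤ 0 := by
    apply aux_except_le _ _ _ _ hk1 le_rfl
    have : (Finset.univ.filter (fun i : Fin M =>
        (0:ℝ) < if (i : ℕ) < k - 1 then (1 : ℝ) else 0)) =
        Finset.univ.filter (fun i : Fin M => (i : ℕ) < k - 1) := by
      ext i
      by_cases hi : (i : ℕ) < k - 1 <;> simp [hi]
    rw [this, aux_card_lt _ (by omega)]
    omega
  have hy := hpos y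
  unfold psi1
  beta_reduce
  by_cases h : (y : ℕ) < k - 1
  · rw [if_pos h, if_neg (by omega), max_eq_right (by linarith), mul_zero]
  · rw [if_neg h, if_pos (by omega)]
    have : max (1 + kthLargestExcept (fun i : Fin M => if (i : ℕ) < k - 1 then (1 : ℝ) else 0) y k
        - 0) 0 ≤ 1 := max_le (by linarith) (by norm_num)
    nlinarith

lemma aux_lower (M k : ℕ) (hk1 : 1 ≤ k) (hMk : k + 2 ≤ M) (η : Fin M → ℝ)
    (hdec : ∀ i j : Fin M, i < j → η j < η i) (hpos : ∀ i, 0 < η i)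
    (hlt : η ⟨k - 1, aux_lt M k hk1 hMk⟩ < ∑ i ∈ Finset.univ.filter (fun i : Fin M => k ≤ (i : ℕ)), η i)
    (s : Fin M → ℝ) :
    ∑ i ∈ Finset.univ.filter (fun i : Fin M => k - 1 ≤ (i : ℕ)), η i ≤
      condRisk (psi1 k) s η := by
  obtain ⟨σ, hσ⟩ : ∃ σ : Equiv.Perm (Fin M), ∀ i j, i ≤ j → s (σ j) ≤ s (σ i) := by
    refine ⟨Tuple.sort (fun i => - s i), fun i j hij => ?_⟩
    have := Tuple.monotone_sort (fun i => - s i) hij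
    simpa using this
  set u : Fin M := ⟨k - 1, aux_lt M k hk1 hMk⟩ with hu
  set v : Fin M := ⟨k, by omega⟩ with hv
  set d := s (σ u) - s (σ v) with hd
  have hd0 : 0 ≤ d := by
    have := hσ u v (by simp [hu, hv, Fin.le_def])
    linarith
  have hψ0 : ∀ y, 0 ≤ psi1 k s y := fun y => le_max_right _ _
  have hψu : 1 - d ≤ psi1 k s (σ u) := by
    have : s (σ v) ≤ kthLargestExcept s (σ u) k := by
      apply aux_le_except _ _ _ _ hk1
        (((Finset.univ.filter (fun i : Fin M => (i : ℕ) < k + 1)).erase u).map σ.toEmbedding)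
      · rw [Finset.card_map, Finset.card_erase_of_mem (by simp [hu]),
          aux_card_lt _ (by omega)]
        omega
      · intro i hi
        simp only [Finset.mem_map, Finset.mem_erase, Finset.mem_filter, Finset.mem_univ, true_and] at hi
        obtain ⟨j, ⟨hj1, hj2⟩, rfl⟩ := hi
        refine ⟨fun h => hj1 (σ.injective h), hσ _ _ ?_⟩
        simp [hv, Fin.le_def]; omega
    refine le_trans ?_ (le_max_left _ _)
    linarith
  have hψt : ∀ j : Fin M, k ≤ (j : ℕ) → 1 + d ≤ psi1 k s (σ j) := by
    intro j hj
    have : s (σ u) ≤ kthLargestExcept s (σ j) k := by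
      apply aux_le_except _ _ _ _ hk1
        ((Finset.univ.filter (fun i : Fin M => (i : ℕ) < k)).map σ.toEmbedding)
      · rw [Finset.card_map, aux_card_lt _ (by omega)]
      · intro i hi
        simp only [Finset.mem_map, Finset.mem_filter, Finset.mem_univ, true_and] at hi
        obtain ⟨i, hi2, rfl⟩ := hi
        refine ⟨fun h => ?_, hσ _ _ ?_⟩
        · have := σ.injective h
          subst this
          omega
        · simp [hu, Fin.le_def]; omega
    have h2 := hσ v j (by simp [hv, Fin.le_def]; omega)
    refine le_trans ?_ (le_max_left _ _)
    linarith
  have hR : η (σ u) * psi1 k s (σ u) +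
      (1 + d) * ∑ i ∈ Finset.univ.filter (fun i : Fin M => k ≤ (i : ℕ)), η (σ i) ≤
      condRisk (psi1 k) s η := by
    unfold condRisk
    rw [← Equiv.sum_comp σ]
    have h1 : ∑ i ∈ Finset.univ.filter (fun i : Fin M => k - 1 ≤ (i : ℕ)), η (σ i) * psi1 k s (σ i)
        ≤ ∑ i, η (σ i) * psi1 k s (σ i) :=
      Finset.sum_le_sum_of_subset_of_nonneg (Finset.filter_subset _ _)
        (fun i _ _ => mul_nonneg (hpos _).le (hψ0 _))
    rw [aux_split k hk1 hMk] at h1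
    refine le_trans ?_ h1
    rw [Finset.mul_sum]
    refine add_le_add le_rfl ?_
    apply Finset.sum_le_sum
    intro i hi
    rw [mul_comm]
    exact mul_le_mul_of_nonneg_left (hψt i (by simpa using hi)) (hpos _).le
  refine le_trans ?_ hR
  have t1 := aux_tail η hdec σ k
  have t2 := aux_tail η hdec σ (k - 1)
  rw [aux_split k hk1 hMk, aux_split k hk1 hMk] at t2
  rw [aux_split k hk1 hMk]
  rw [← hu] at *
  generalize ∑ i ∈ Finset.univ.filter (fun i : Fin M => k ≤ (i : ℕ)), η (σ i) = A at *
  generalize ∑ i ∈ Finset.univ.filter (fun i : Fin M => k ≤ (i : ℕ)), η i = B at *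
  have hp := hpos (σ u)
  have hq := hpos u
  have h0 := hψ0 (σ u)
  generalize psi1 k s (σ u) = z at *
  generalize η (σ u) = p at *
  generalize η u = q at *
  rcases le_total p q with h | h
  · nlinarith [mul_le_mul_of_nonneg_left hψu hp.le, mul_nonneg hd0 (show 0 ≤ A - p by linarith)]
  · nlinarith [mul_le_mul_of_nonneg_left hψu hq.le, mul_nonneg hd0 (show 0 ≤ A - q by linarith),
      mul_nonneg h0 (show 0 ≤ p - q by linarith)]

lemma aux_not_pres (M k : ℕ) (hk1 : 1 ≤ k) (hMk : k + 2 ≤ M) (η : Fin M → ℝ)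
    (hdec : ∀ i j : Fin M, i < j → η j < η i) (hpos : ∀ i, 0 < η i) :
    ¬ TopkPreserving k (fun i : Fin M => if (i : ℕ) < k - 1 then (1 : ℝ) else 0) η := by
  intro h
  have h1 := (h ⟨k - 1, aux_lt M k hk1 hMk⟩).1
  have h2 : kthLargest η (k + 1) ≤ η ⟨k, by omega⟩ := by
    apply aux_kth_le _ _ _ (by omega) (hpos _).le
    rw [aux_count η (fun x => η ⟨k, by omega⟩ < x)]
    have : (Finset.univ.filter (fun i => η ⟨k, by omega⟩ < η i)).card ≤
        (Finset.univ.filter (fun i : Fin M => (i : ℕ) < k)).card := by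
      apply Finset.card_le_card
      intro i hi
      simp only [Finset.mem_filter, Finset.mem_univ, true_and] at hi ⊢
      by_contra hn
      rcases Nat.lt_or_ge k i with h3 | h3
      · have := hdec ⟨k, by omega⟩ i (by simpa [Fin.lt_def] using h3)
        linarith
      · have : i = ⟨k, by omega⟩ := by ext; simp; omega
        rw [← this] at hi
        exact lt_irrefl _ hi
    rw [aux_card_lt _ (by omega)] at this
    omega
  have h3 := hdec ⟨k - 1, aux_lt M k hk1 hMk⟩ ⟨k, by omega⟩ (by simp [Fin.lt_def]; omega)
  have h4 := h1 (lt_of_le_of_lt h2 h3)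
  have h5 : (0 : ℝ) ≤ kthLargest (fun i : Fin M => if (i : ℕ) < k - 1 then (1 : ℝ) else 0) (k + 1) := by
    apply aux_le_kth _ _ _ (by omega)
    rw [aux_count _ (fun x => (0 : ℝ) ≤ x), Finset.filter_true_of_mem]
    · simp; omega
    · intro i _
      split_ifs <;> norm_num
  simp at h4
  linarith

lemma aux_exists (M k : ℕ) (hk1 : 1 ≤ k) (hMk : k + 2 ≤ M) :
    ∃ η : Fin M → ℝ, η ∈ Simplex M ∧ (∀ i j : Fin M, i < j → η j < η i) ∧
      (∀ i : Fin M, 0 < η i) ∧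
      (η ⟨k - 1, aux_lt M k hk1 hMk⟩ < ∑ i ∈ Finset.univ.filter (fun i : Fin M => k ≤ (i : ℕ)), η i) := by
  set w : Fin M → ℝ := fun i => (M : ℝ) + 1 - (i : ℕ) with hw
  have hwpos : ∀ i, 0 < w i := by
    intro i
    have : ((i : ℕ) : ℝ) < M := by exact_mod_cast i.2
    simp only [hw]; linarith
  set W := ∑ i, w i with hW
  have hWpos : 0 < W := Finset.sum_pos (fun i _ => hwpos i) ⟨⟨0, by omega⟩, by simp⟩
  refine ⟨fun i => w i / W, ⟨fun m => (div_pos (hwpos m) hWpos).le, ?_⟩, ?_,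
    fun m => div_pos (hwpos m) hWpos, ?_⟩
  · rw [← Finset.sum_div, div_self hWpos.ne']
  · intro i j hij
    apply div_lt_div_of_pos_right _ hWpos
    have : ((i : ℕ) : ℝ) < (j : ℕ) := by exact_mod_cast hij
    simp only [hw]; linarith
  · rw [← Finset.sum_div]
    apply div_lt_div_of_pos_right _ hWpos
    have hsub : ∑ i ∈ ({⟨k, by omega⟩, ⟨k + 1, by omega⟩} : Finset (Fin M)), w i ≤
        ∑ i ∈ Finset.univ.filter (fun i : Fin M => k ≤ (i : ℕ)), w i := by
      apply Finset.sum_le_sum_of_subset_of_nonneg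
      · intro i hi
        simp only [Finset.mem_insert, Finset.mem_singleton] at hi
        rcases hi with rfl | rfl <;> simp
      · exact fun i _ _ => (hwpos i).le
    rw [Finset.sum_pair (by simp)] at hsub
    refine lt_of_lt_of_le ?_ hsub
    simp only [hw]
    have : (k : ℝ) + 2 ≤ M := by exact_mod_cast hMk
    push_cast [Nat.cast_sub hk1]
    linarith

theorem stmt10 (M k : ℕ) (hM : 2 ≤ M) (hk1 : 1 ≤ k) (hkM : k ≤ M - 1) (hMk : k + 2 ≤ M) :
    ¬ TopkCalibrated M k (psi1 k) ∧
    ∀ η : Fin M → ℝ, η ∈ Simplex M →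
      (∀ i j : Fin M, i < j → η j < η i) →
      (∀ i : Fin M, 0 < η i) →
      (η ⟨k - 1, by omega⟩ < ∑ i ∈ Finset.univ.filter (fun i : Fin M => k ≤ (i : ℕ)), η i) →
      ((∀ s : Fin M → ℝ,
            condRisk (psi1 k) (fun i => if (i : ℕ) < k - 1 then (1 : ℝ) else 0) η ≤
              condRisk (psi1 k) s η) ∧
        ¬ TopkPreserving k (fun i => if (i : ℕ) < k - 1 then (1 : ℝ) else 0) η ∧
        sInf {L | ∃ s : Fin M → ℝ, ¬ TopkPreserving k s η ∧ L = condRisk (psi1 k) s η} =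
          sInf {L | ∃ s : Fin M → ℝ, L = condRisk (psi1 k) s η}) := by
  have main : ∀ η : Fin M → ℝ, η ∈ Simplex M →
      (∀ i j : Fin M, i < j → η j < η i) →
      (∀ i : Fin M, 0 < η i) →
      (η ⟨k - 1, by omega⟩ < ∑ i ∈ Finset.univ.filter (fun i : Fin M => k ≤ (i : ℕ)), η i) →
      ((∀ s : Fin M → ℝ,
            condRisk (psi1 k) (fun i => if (i : ℕ) < k - 1 then (1 : ℝ) else 0) η ≤
              condRisk (psi1 k) s η) ∧
        ¬ TopkPreserving k (fun i => if (i : ℕ) < k - 1 then (1 : ℝ) else 0) η ∧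
        sInf {L | ∃ s : Fin M → ℝ, ¬ TopkPreserving k s η ∧ L = condRisk (psi1 k) s η} =
          sInf {L | ∃ s : Fin M → ℝ, L = condRisk (psi1 k) s η}) := by
    intro η _ hdec hpos hlt
    have h1 : ∀ s : Fin M → ℝ,
        condRisk (psi1 k) (fun i => if (i : ℕ) < k - 1 then (1 : ℝ) else 0) η ≤
          condRisk (psi1 k) s η := fun s =>
      (aux_risk_a M k hk1 hMk η hpos).trans (aux_lower M k hk1 hMk η hdec hpos hlt s)
    have h2 := aux_not_pres M k hk1 hMk η hdec hpos
    refine ⟨h1, h2, ?_⟩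
    have l1 : IsLeast {L | ∃ s : Fin M → ℝ, ¬ TopkPreserving k s η ∧ L = condRisk (psi1 k) s η}
        (condRisk (psi1 k) (fun i => if (i : ℕ) < k - 1 then (1 : ℝ) else 0) η) := by
      refine ⟨⟨_, h2, rfl⟩, ?_⟩
      rintro _ ⟨s, _, rfl⟩
      exact h1 s
    have l2 : IsLeast {L | ∃ s : Fin M → ℝ, L = condRisk (psi1 k) s η}
        (condRisk (psi1 k) (fun i => if (i : ℕ) < k - 1 then (1 : ℝ) else 0) η) := by
      refine ⟨⟨_, rfl⟩, ?_⟩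
      rintro _ ⟨s, rfl⟩
      exact h1 s
    rw [l1.csInf_eq, l2.csInf_eq]
  refine ⟨fun hcal => ?_, main⟩
  obtain ⟨η, hη, hdec, hpos, hlt⟩ := aux_exists M k hk1 hMk
  have h1 := hcal η hη
  rw [(main η hη hdec hpos hlt).2.2] at h1
  exact lt_irrefl _ h1
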